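/- arXiv:2105.09433 — 7 statements merged into one kernel-verified Lean document; each statement's English description precedes it below -/
import Mathlib

section
/- Let X ∈ ℝ^{n×d}, y ∈ ℝ^n, let S ∈ ℝ^{m×n} be any matrix, let 0 < ε < 1/2, and let β* be a minimizer of β ↦ ‖Xβ − y‖₁. Suppose that for all β ∈ ℝ^d, (‖SXβ* − Sy‖₁ − ‖SXβ − Sy‖₁) − (‖Xβ* − y‖₁ − ‖Xβ − y‖₁) ≤ ε·‖X(β* − β)‖₁. Then every minimizer β̂ of β ↦ ‖SXβ − Sy‖₁ satisfies ‖Xβ̂ − y‖₁ ≤ (1+4ε)·‖Xβ* − y‖₁. -/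
open Finset Matrix

noncomputable section

/-- The ℓ1 norm of a vector. -/
def l1 {n : ℕ} (v : Fin n → ℝ) : ℝ := ∑ i, |v i|

theorem l1_nonneg {n : ℕ} (v : Fin n → ℝ) : 0 ≤ l1 v :=
  Finset.sum_nonneg fun _ _ => abs_nonneg _

theorem l1_sub_le {n : ℕ} (u v : Fin n → ℝ) : l1 (u - v) ≤ l1 u + l1 v := by
  unfold l1
  rw [← Finset.sum_add_distrib]
  exact Finset.sum_le_sum fun i _ => abs_sub (u i) (v i)

/-- If `S` uniformly preserves relative errors up to `ε‖X(β* − β)‖₁`, then any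
empirical minimizer is a `(1 + 4ε)`-approximate minimizer. -/
theorem stmt3 {n d m : ℕ} (X : Matrix (Fin n) (Fin d) ℝ) (y : Fin n → ℝ)
    (S : Matrix (Fin m) (Fin n) ℝ) (ε : ℝ) (hε0 : 0 < ε) (hε : ε < 1 / 2)
    (βs : Fin d → ℝ) (hβs : ∀ β : Fin d → ℝ, l1 (X.mulVec βs - y) ≤ l1 (X.mulVec β - y))
    (hdev : ∀ β : Fin d → ℝ,
      (l1 ((S * X).mulVec βs - S.mulVec y) - l1 ((S * X).mulVec β - S.mulVec y)) -
        (l1 (X.mulVec βs - y) - l1 (X.mulVec β - y)) ≤ ε * l1 (X.mulVec (βs - β)))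
    (βh : Fin d → ℝ)
    (hβh : ∀ β : Fin d → ℝ,
      l1 ((S * X).mulVec βh - S.mulVec y) ≤ l1 ((S * X).mulVec β - S.mulVec y)) :
    l1 (X.mulVec βh - y) ≤ (1 + 4 * ε) * l1 (X.mulVec βs - y) := by
  have htri : l1 (X.mulVec (βs - βh)) ≤ l1 (X.mulVec βs - y) + l1 (X.mulVec βh - y) := by
    have h := l1_sub_le (X.mulVec βs - y) (X.mulVec βh - y)
    rwa [sub_sub_sub_cancel_right, ← Matrix.mulVec_sub] at h
  have hnonneg := l1_nonneg (X.mulVec βs - y)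
  have hbound : (1 - ε) * l1 (X.mulVec βh - y) ≤ (1 + ε) * l1 (X.mulVec βs - y) := by
    linarith [hdev βh, hβh βs, mul_le_mul_of_nonneg_left htri hε0.le]
  have hcoeff : 1 + ε ≤ (1 - ε) * (1 + 4 * ε) := by nlinarith
  refine le_of_mul_le_mul_left (hbound.trans ?_) (by linarith : 0 < 1 - ε)
  rw [← mul_assoc]
  exact mul_le_mul_of_nonneg_right hcoeff hnonneg
end
end

section
/- Let X ∈ ℝ^{n×d}, y ∈ ℝ^n, and let S ∈ ℝ^{m×n} satisfy ‖Xβ‖₁ ≤ 2·‖SXβ‖₁ for all β ∈ ℝ^d. Let β* be a minimizer of β ↦ ‖Xβ − y‖₁, suppose ‖SXβ* − Sy‖₁ ≤ 10·‖Xβ* − y‖₁, and let β̂ be a minimizer of β ↦ ‖SXβ − Sy‖₁. Then ‖Xβ̂ − y‖₁ ≤ 41·‖Xβ* − y‖₁. -/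
open Finset Matrix

noncomputable section

theorem l1_add_le {n : ℕ} (u v : Fin n → ℝ) : l1 (u + v) ≤ l1 u + l1 v := by
  unfold l1
  rw [← Finset.sum_add_distrib]
  exact Finset.sum_le_sum fun i _ => abs_add_le (u i) (v i)

/-- Constant-factor approximation from a constant-factor subspace embedding. -/
theorem stmt5 {n d m : ℕ} (X : Matrix (Fin n) (Fin d) ℝ) (y : Fin n → ℝ)
    (S : Matrix (Fin m) (Fin n) ℝ)
    (hemb : ∀ β : Fin d → ℝ, l1 (X.mulVec β) ≤ 2 * l1 ((S * X).mulVec β))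
    (βs : Fin d → ℝ) (hβs : ∀ β : Fin d → ℝ, l1 (X.mulVec βs - y) ≤ l1 (X.mulVec β - y))
    (hS : l1 ((S * X).mulVec βs - S.mulVec y) ≤ 10 * l1 (X.mulVec βs - y))
    (βh : Fin d → ℝ)
    (hβh : ∀ β : Fin d → ℝ,
      l1 ((S * X).mulVec βh - S.mulVec y) ≤ l1 ((S * X).mulVec β - S.mulVec y)) :
    l1 (X.mulVec βh - y) ≤ 41 * l1 (X.mulVec βs - y) := by
  have hX : l1 (X.mulVec βh - y) ≤ l1 (X.mulVec (βh - βs)) + l1 (X.mulVec βs - y) := by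
    have h := l1_add_le (X.mulVec (βh - βs)) (X.mulVec βs - y)
    rwa [Matrix.mulVec_sub, sub_add_sub_cancel, ← Matrix.mulVec_sub] at h
  have hSX : l1 ((S * X).mulVec (βh - βs)) ≤
      l1 ((S * X).mulVec βh - S.mulVec y) + l1 ((S * X).mulVec βs - S.mulVec y) := by
    have h := l1_sub_le ((S * X).mulVec βh - S.mulVec y) ((S * X).mulVec βs - S.mulVec y)
    rwa [sub_sub_sub_cancel_right, ← Matrix.mulVec_sub] at h
  linarith [hemb (βh - βs), hβh βs]
end
end

section
/- Let X ∈ ℝ^{n×d} have rows x_1,…,x_n, let y ∈ ℝ^n, let β* ∈ ℝ^d, let N be a positive integer, let p_1,…,p_n be positive reals with Σ_{i=1}^n p_i = N, and let l ≥ 1 be an integer. Let i_1,…,i_N ∈ {1,…,n} be i.i.d. with P(i_k = i) = p_i/N, let S ∈ ℝ^{N×n} be the corresponding sampling-and-reweighting matrix (so ‖Sv‖₁ = Σ_{k=1}^N |v_{i_k}|/p_{i_k}), and let σ_1,…,σ_N be independent uniform ±1 random variables, independent of the indices. Define M = E[ ( sup over β ∈ ℝ^d with ‖X(β* − β)‖₁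 = 1 of | (‖SXβ* − Sy‖₁ − ‖SXβ − Sy‖₁) − (‖Xβ* − y‖₁ − ‖Xβ − y‖₁) | )^l ]. Then M ≤ 2^l · E[ ( sup over β ∈ ℝ^d with ‖X(β* − β)‖₁ = 1 of | Σ_{k=1}^N σ_k·( |x_{i_k}ᵀβ* − y_{i_k}|/p_{i_k} − |x_{i_k}ᵀβ − y_{i_k}|/p_{i_k} ) | )^l ]. -/
open Finset Matrix
open scoped Classical

noncomputable section

/-- The matrix `A = ∑ j (1/w j) xⱼ xⱼᵀ` used in the definition of ℓ1 Lewis weights. -/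
def lewisMatrix {ι : Type*} [Fintype ι] {d : ℕ}
    (X : Matrix ι (Fin d) ℝ) (w : ι → ℝ) : Matrix (Fin d) (Fin d) ℝ :=
  ∑ j, (w j)⁻¹ • vecMulVec (X j) (X j)

/-- `w` is a family of ℓ1 Lewis weights for `X`. -/
def IsLewisWeights {ι : Type*} [Fintype ι] {d : ℕ}
    (X : Matrix ι (Fin d) ℝ) (w : ι → ℝ) : Prop :=
  (∀ i, 0 < w i) ∧ IsUnit (lewisMatrix X w) ∧
    ∀ i, (w i) ^ 2 = X i ⬝ᵥ (lewisMatrix X w)⁻¹.mulVec (X i)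

/-- The sampling-and-reweighting matrix determined by the sampled indices `ι`. -/
def sampleMatrix {n N : ℕ} (p : Fin n → ℝ) (ι : Fin N → Fin n) :
    Matrix (Fin N) (Fin n) ℝ :=
  fun k j => if j = ι k then (p (ι k))⁻¹ else 0

/-- Probability of the event `E` under i.i.d. sampling of `N` indices with `P(i) = p i / N`. -/
def eventProb {n : ℕ} (N : ℕ) (p : Fin n → ℝ) (E : (Fin N → Fin n) → Prop) : ℝ :=
  ∑ ι : Fin N → Fin n, if E ι then ∏ k, p (ι k) / N else 0

/-- Expectation (over i.i.d. indices with `P(i) = p i / N` and independent uniform ±1 signs)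
of a function of the indices and signs. -/
def rexp {n : ℕ} (N : ℕ) (p : Fin n → ℝ)
    (f : (Fin N → Fin n) → (Fin N → ℝ) → ℝ) : ℝ :=
  ∑ ι : Fin N → Fin n, ∑ s : Fin N → Bool,
    (∏ k, p (ι k) / N) * (1 / 2 : ℝ) ^ N * f ι (fun k => if s k then 1 else -1)

section Symmetrization

variable {α κ T : Type*}

/-- Exchanging the coordinates of a pair of tuples wherever the sign is negative. -/
def swapWhere (s : κ → Bool) : Equiv.Perm ((κ → α) × (κ → α)) :=
  Function.Involutive.toPerm
    (fun c => (fun k => if s k then c.1 k else c.2 k, fun k => if s k then c.2 k else c.1 k))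
    (fun c => by
      ext k <;> by_cases h : s k <;> simp [h])

lemma swapWhere_fst (s : κ → Bool) (c : (κ → α) × (κ → α)) (k : κ) :
    (swapWhere s c).1 k = if s k then c.1 k else c.2 k := rfl

lemma swapWhere_snd (s : κ → Bool) (c : (κ → α) × (κ → α)) (k : κ) :
    (swapWhere s c).2 k = if s k then c.2 k else c.1 k := rfl

/-- The real sign attached to a Boolean. -/
def boolSign (b : Bool) : ℝ := if b then 1 else -1

lemma abs_boolSign (b : Bool) : |boolSign b| = 1 := by cases b <;> simp [boolSign]

variable [Fintype κ]

/-- The supremum over `t` of `|∑ k, f t k|`. -/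
def supAbsSum (f : T → κ → ℝ) : ℝ := ⨆ t, |∑ k, f t k|

lemma supAbsSum_nonneg (f : T → κ → ℝ) : 0 ≤ supAbsSum f :=
  Real.iSup_nonneg fun _ => abs_nonneg _

lemma abs_sum_le_supAbsSum {f : T → κ → ℝ} {C : κ → ℝ} (hf : ∀ t k, |f t k| ≤ C k) (t : T) :
    |∑ k, f t k| ≤ supAbsSum f := by
  refine le_ciSup (f := fun t => |∑ k, f t k|) ⟨∑ k, C k, ?_⟩ t
  rintro _ ⟨t, rfl⟩
  exact (Finset.abs_sum_le_sum_abs _ _).trans (Finset.sum_le_sum fun k _ => hf t k)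

lemma supAbsSum_sub_le {f g : T → κ → ℝ} {C D : κ → ℝ} (hf : ∀ t k, |f t k| ≤ C k)
    (hg : ∀ t k, |g t k| ≤ D k) :
    supAbsSum (fun t k => f t k - g t k) ≤ supAbsSum f + supAbsSum g := by
  refine Real.iSup_le (fun t => ?_) (add_nonneg (supAbsSum_nonneg f) (supAbsSum_nonneg g))
  rw [Finset.sum_sub_distrib]
  exact (abs_sub _ _).trans
    (add_le_add (abs_sum_le_supAbsSum hf t) (abs_sum_le_supAbsSum hg t))

/-- The product weight of a tuple. -/
def tupleWeight (q : α → ℝ) (a : κ → α) : ℝ := ∏ k, q (a k)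

lemma tupleWeight_nonneg {q : α → ℝ} (hq : ∀ i, 0 ≤ q i) (a : κ → α) : 0 ≤ tupleWeight q a :=
  Finset.prod_nonneg fun k _ => hq (a k)

variable [Fintype α] [DecidableEq κ]

lemma sum_tupleWeight {q : α → ℝ} (hq1 : ∑ i, q i = 1) :
    ∑ a : κ → α, tupleWeight q a = 1 := by
  simp only [tupleWeight, ← Fintype.prod_sum (fun (_ : κ) i => q i), hq1, Finset.prod_const_one]

lemma sum_tupleWeight_mul_apply {q : α → ℝ} (hq1 : ∑ i, q i = 1) (g : α → ℝ) (k₀ : κ) :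
    ∑ a : κ → α, tupleWeight q a * g (a k₀) = ∑ i, q i * g i := by
  have h := Fintype.prod_sum (fun (k : κ) i => q i * if k = k₀ then g i else 1)
  have hl : ∏ k : κ, ∑ i, q i * (if k = k₀ then g i else 1) = ∑ i, q i * g i := by
    rw [Fintype.prod_eq_single k₀ (fun k hk => by simp [hk, hq1])]
    simp
  rw [← hl, h]
  refine Finset.sum_congr rfl fun a _ => ?_
  rw [Finset.prod_mul_distrib, tupleWeight]
  simp

lemma sum_pair_swap {q : α → ℝ} (h : T → α → ℝ) (l : ℕ) (s : κ → Bool) :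
    ∑ c : (κ → α) × (κ → α), tupleWeight q c.1 * tupleWeight q c.2 *
        supAbsSum (fun t k => h t (c.1 k) - h t (c.2 k)) ^ l =
      ∑ c : (κ → α) × (κ → α), tupleWeight q c.1 * tupleWeight q c.2 *
        supAbsSum (fun t k => boolSign (s k) * h t (c.1 k) -
          boolSign (s k) * h t (c.2 k)) ^ l := by
  rw [← Equiv.sum_comp (swapWhere s)]
  refine Finset.sum_congr rfl fun c _ => ?_
  congr 1
  · simp only [tupleWeight, ← Finset.prod_mul_distrib]
    refine Finset.prod_congr rfl fun k _ => ?_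
    by_cases hs : s k <;> simp [swapWhere_fst, swapWhere_snd, hs, mul_comm]
  · congr 2
    ext t k
    by_cases hs : s k <;> simp [swapWhere_fst, swapWhere_snd, hs, boolSign, neg_add_eq_sub]

/-- Ghost-sample bound: centering is dominated by an independent copy. -/
lemma supAbs_centered_pow_le {q : α → ℝ} (hq : ∀ i, 0 ≤ q i) (hq1 : ∑ i, q i = 1)
    {h : T → α → ℝ} {C : α → ℝ} (hC : ∀ t i, |h t i| ≤ C i) (l : ℕ) (a : κ → α) :
    (⨆ t, |∑ k, h t (a k) - Fintype.card κ * ∑ i, q i * h t i|) ^ l ≤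
      ∑ b : κ → α, tupleWeight q b *
        supAbsSum (fun t k => h t (a k) - h t (b k)) ^ l := by
  have hw := tupleWeight_nonneg (κ := κ) hq
  refine le_trans (pow_le_pow_left₀ (Real.iSup_nonneg fun _ => abs_nonneg _) ?_ l)
    (Real.pow_arith_mean_le_arith_mean_pow Finset.univ (tupleWeight q)
      (fun b => supAbsSum (fun t k => h t (a k) - h t (b k))) (fun b _ => hw b)
      (sum_tupleWeight hq1) (fun b _ => supAbsSum_nonneg _) l)
  refine Real.iSup_le (fun t => ?_)
    (Finset.sum_nonneg fun b _ => mul_nonneg (hw b) (supAbsSum_nonneg _))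
  have hmean : ∑ b : κ → α, tupleWeight q b * ∑ k, h t (b k) =
      Fintype.card κ * ∑ i, q i * h t i := by
    rw [Finset.sum_congr rfl fun b _ => Finset.mul_sum _ _ _, Finset.sum_comm]
    simp [sum_tupleWeight_mul_apply hq1 (h t)]
  have hcenter : ∑ k, h t (a k) - Fintype.card κ * ∑ i, q i * h t i =
      ∑ b : κ → α, tupleWeight q b * ∑ k, (h t (a k) - h t (b k)) := by
    simp_rw [Finset.sum_sub_distrib, mul_sub, Finset.sum_sub_distrib, hmean]
    rw [← Finset.sum_mul, sum_tupleWeight hq1, one_mul]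
  rw [hcenter]
  refine (Finset.abs_sum_le_sum_abs _ _).trans (Finset.sum_le_sum fun b _ => ?_)
  rw [abs_mul, abs_of_nonneg (hw b)]
  refine mul_le_mul_of_nonneg_left ?_ (hw b)
  exact abs_sum_le_supAbsSum (f := fun t k => h t (a k) - h t (b k))
    (C := fun k => C (a k) + C (b k))
    (fun t k => (abs_sub _ _).trans (add_le_add (hC t _) (hC t _))) t

/-- For each fixed sign pattern, the pair moment is at most `2 ^ l` times the signed moment. -/
lemma sum_pair_le {q : α → ℝ} (hq : ∀ i, 0 ≤ q i) (hq1 : ∑ i, q i = 1)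
    {h : T → α → ℝ} {C : α → ℝ} (hC : ∀ t i, |h t i| ≤ C i) {l : ℕ} (hl : 1 ≤ l)
    (s : κ → Bool) :
    ∑ c : (κ → α) × (κ → α), tupleWeight q c.1 * tupleWeight q c.2 *
        supAbsSum (fun t k => boolSign (s k) * h t (c.1 k) -
          boolSign (s k) * h t (c.2 k)) ^ l ≤
      2 ^ l * ∑ a : κ → α, tupleWeight q a *
        supAbsSum (fun t k => boolSign (s k) * h t (a k)) ^ l := by
  have hw := tupleWeight_nonneg (κ := κ) hq
  set R : (κ → α) → ℝ := fun a => supAbsSum (fun t k => boolSign (s k) * h t (a k)) with hR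
  have hbound (a : κ → α) (t : T) (k : κ) : |boolSign (s k) * h t (a k)| ≤ C (a k) := by
    rw [abs_mul, abs_boolSign, one_mul]
    exact hC t _
  calc _ ≤ ∑ c : (κ → α) × (κ → α), tupleWeight q c.1 * tupleWeight q c.2 *
        (2 ^ (l - 1) * (R c.1 ^ l + R c.2 ^ l)) := by
        refine Finset.sum_le_sum fun c _ =>
          mul_le_mul_of_nonneg_left ?_ (mul_nonneg (hw _) (hw _))
        exact (pow_le_pow_left₀ (supAbsSum_nonneg _)
          (supAbsSum_sub_le (hbound c.1) (hbound c.2)) l).trans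
          (add_pow_le (supAbsSum_nonneg _) (supAbsSum_nonneg _) l)
    _ = 2 ^ (l - 1) * (∑ a, ∑ b, tupleWeight q b * (tupleWeight q a * R a ^ l) +
          ∑ a, ∑ b, tupleWeight q a * (tupleWeight q b * R b ^ l)) := by
        rw [Fintype.sum_prod_type, ← Finset.sum_add_distrib, Finset.mul_sum]
        refine Finset.sum_congr rfl fun a _ => ?_
        rw [← Finset.sum_add_distrib, Finset.mul_sum]
        refine Finset.sum_congr rfl fun b _ => ?_
        ring
    _ = 2 ^ l * ∑ a : κ → α, tupleWeight q a * R a ^ l := by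
        simp_rw [← Finset.mul_sum, ← Finset.sum_mul, sum_tupleWeight hq1, one_mul]
        obtain ⟨m, rfl⟩ := Nat.exists_eq_add_of_le' hl
        rw [Nat.add_sub_cancel]
        ring

/-- Symmetrization for the moments of a bounded process sampled i.i.d. from a finite type. -/
lemma symmetrization_moment_le {q : α → ℝ} (hq : ∀ i, 0 ≤ q i) (hq1 : ∑ i, q i = 1)
    {h : T → α → ℝ} {C : α → ℝ} (hC : ∀ t i, |h t i| ≤ C i) {l : ℕ} (hl : 1 ≤ l)
    (s : κ → Bool) :
    ∑ a : κ → α, tupleWeight q a *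
        (⨆ t, |∑ k, h t (a k) - Fintype.card κ * ∑ i, q i * h t i|) ^ l ≤
      2 ^ l * ∑ a : κ → α, tupleWeight q a *
        supAbsSum (fun t k => boolSign (s k) * h t (a k)) ^ l := by
  refine le_trans ?_ ((sum_pair_swap h l s).trans_le (sum_pair_le hq hq1 hC hl s))
  rw [Fintype.sum_prod_type]
  refine Finset.sum_le_sum fun a _ => ?_
  simp_rw [mul_assoc, ← Finset.mul_sum]
  exact mul_le_mul_of_nonneg_left (supAbs_centered_pow_le hq hq1 hC l a)
    (tupleWeight_nonneg hq a)

end Symmetrization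

lemma rexp_le_of_forall_sign {n N : ℕ} {p : Fin n → ℝ}
    {f g : (Fin N → Fin n) → (Fin N → ℝ) → ℝ} {c : ℝ}
    (H : ∀ s : Fin N → Bool,
      ∑ a, tupleWeight (fun i => p i / N) a * f a (fun k => boolSign (s k)) ≤
        c * ∑ a, tupleWeight (fun i => p i / N) a * g a (fun k => boolSign (s k))) :
    rexp N p f ≤ c * rexp N p g := by
  have key (f : (Fin N → Fin n) → (Fin N → ℝ) → ℝ) : rexp N p f =
      (1 / 2 : ℝ) ^ N * ∑ s : Fin N → Bool,
        ∑ a, tupleWeight (fun i => p i / N) a * f a (fun k => boolSign (s k)) := by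
    rw [rexp, Finset.sum_comm, Finset.mul_sum]
    refine Finset.sum_congr rfl fun s _ => ?_
    rw [Finset.mul_sum]
    refine Finset.sum_congr rfl fun a _ => ?_
    simp only [tupleWeight, boolSign]
    ring
  rw [key, key, mul_left_comm, Finset.mul_sum Finset.univ _ c]
  exact mul_le_mul_of_nonneg_left (Finset.sum_le_sum fun s _ => H s) (by positivity)

lemma sampleMatrix_mulVec {n N : ℕ} (p : Fin n → ℝ) (ι : Fin N → Fin n) (v : Fin n → ℝ)
    (k : Fin N) : (sampleMatrix p ι).mulVec v k = (p (ι k))⁻¹ * v (ι k) := by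
  simp [sampleMatrix, mulVec, dotProduct]

lemma l1_sampleMatrix_residual {n d N : ℕ} (X : Matrix (Fin n) (Fin d) ℝ) (y : Fin n → ℝ)
    {p : Fin n → ℝ} (hp : ∀ i, 0 < p i) (ι : Fin N → Fin n) (b : Fin d → ℝ) :
    l1 ((sampleMatrix p ι * X).mulVec b - (sampleMatrix p ι).mulVec y) =
      ∑ k, |X (ι k) ⬝ᵥ b - y (ι k)| / p (ι k) := by
  refine Finset.sum_congr rfl fun k _ => ?_
  rw [← mulVec_mulVec, Pi.sub_apply, sampleMatrix_mulVec, sampleMatrix_mulVec, ← mul_sub,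
    abs_mul, abs_inv, abs_of_pos (hp _), div_eq_inv_mul]
  rfl

lemma abs_residual_sub_le {n d : ℕ} (X : Matrix (Fin n) (Fin d) ℝ) (y : Fin n → ℝ)
    {p : Fin n → ℝ} (hp : ∀ i, 0 < p i) (βs b : Fin d → ℝ) (i : Fin n) :
    |(|X i ⬝ᵥ βs - y i| / p i - |X i ⬝ᵥ b - y i| / p i)| ≤ l1 (X.mulVec (βs - b)) / p i := by
  rw [← sub_div, abs_div, abs_of_pos (hp i)]
  refine div_le_div_of_nonneg_right ?_ (hp i).le
  calc _ ≤ |X i ⬝ᵥ βs - y i - (X i ⬝ᵥ b - y i)| := abs_abs_sub_abs_le_abs_sub _ _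
    _ = |X.mulVec (βs - b) i| := by
        rw [mulVec_sub, Pi.sub_apply, sub_sub_sub_cancel_right]; rfl
    _ ≤ _ := Finset.single_le_sum (f := fun i => |X.mulVec (βs - b) i|)
        (fun _ _ => abs_nonneg _) (Finset.mem_univ i)


/-- Symmetrization: the `l`-th moment of the maximal relative-error deviation is bounded by
`2^l` times the corresponding symmetrized Rademacher moment. -/
theorem stmt6 {n d : ℕ} (X : Matrix (Fin n) (Fin d) ℝ) (y : Fin n → ℝ) (βs : Fin d → ℝ)
    (N : ℕ) (hN : 0 < N) (p : Fin n → ℝ) (hp : ∀ i, 0 < p i)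
    (hsum : (∑ i, p i) = (N : ℝ)) (l : ℕ) (hl : 1 ≤ l) :
    rexp N p (fun ι _σ =>
        (⨆ β : {b : Fin d → ℝ // l1 (X.mulVec (βs - b)) = 1},
          |(l1 ((sampleMatrix p ι * X).mulVec βs - (sampleMatrix p ι).mulVec y) -
              l1 ((sampleMatrix p ι * X).mulVec β.1 - (sampleMatrix p ι).mulVec y)) -
            (l1 (X.mulVec βs - y) - l1 (X.mulVec β.1 - y))|) ^ l) ≤
      2 ^ l * rexp N p (fun ι σ =>
        (⨆ β : {b : Fin d → ℝ // l1 (X.mulVec (βs - b)) = 1},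
          |∑ k, σ k * (|X (ι k) ⬝ᵥ βs - y (ι k)| / p (ι k) -
            |X (ι k) ⬝ᵥ β.1 - y (ι k)| / p (ι k))|) ^ l) := by
  set h : {b : Fin d → ℝ // l1 (X.mulVec (βs - b)) = 1} → Fin n → ℝ := fun β i =>
    |X i ⬝ᵥ βs - y i| / p i - |X i ⬝ᵥ β.1 - y i| / p i with hh
  have hN0 : (N : ℝ) ≠ 0 := by positivity
  have hq (i : Fin n) : 0 ≤ p i / N := div_nonneg (hp i).le (Nat.cast_nonneg N)
  have hq1 : ∑ i, p i / N = 1 := by rw [← Finset.sum_div, hsum, div_self hN0]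
  have hC (β) (i : Fin n) : |h β i| ≤ 1 / p i := by
    simpa [hh, β.2] using abs_residual_sub_le X y hp βs β.1 i
  have hmean (β : {b : Fin d → ℝ // l1 (X.mulVec (βs - b)) = 1}) :
      l1 (X.mulVec βs - y) - l1 (X.mulVec β.1 - y) =
        Fintype.card (Fin N) * ∑ i, p i / N * h β i := by
    rw [l1, l1, ← Finset.sum_sub_distrib, Finset.mul_sum, Fintype.card_fin]
    refine Finset.sum_congr rfl fun i _ => ?_
    have := (hp i).ne'
    simp only [hh, Pi.sub_apply, mulVec]
    field_simp
  refine rexp_le_of_forall_sign fun s => ?_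
  simp_rw [l1_sampleMatrix_residual X y hp, hmean, ← Finset.sum_sub_distrib]
  exact symmetrization_moment_le hq hq1 hC hl s
end
end

section
/- Let X ∈ ℝ^{n×d} have rows x_1,…,x_n, let y ∈ ℝ^n, let β* ∈ ℝ^d, let N be a positive integer, let p_1,…,p_n be positive reals with Σ_{i=1}^n p_i = N, and let l ≥ 1 be an integer. Let i_1,…,i_N ∈ {1,…,n} be i.i.d. with P(i_k = i) = p_i/N and let σ_1,…,σ_N be independent uniform ±1 random variables, independent of the indices. Then E[ ( sup over β ∈ ℝ^d with ‖X(β* − β)‖₁ = 1 of | Σ_{k=1}^N σ_k·( |x_{i_k}ᵀβ* − y_{i_k}|/p_{i_k} − |x_{i_k}ᵀβ − y_{i_k}|/p_{i_k} ) | )^l ] ≤ 2^{l+1} · E[ ( sup over β ∈ ℝ^d with ‖X(β* − β)‖₁ = 1 of | Σ_{k=1}^N σ_k·( x_{i_k}ᵀ(β* − β) )/p_{i_k} | )^l ]. -/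
open Finset Matrix
open scoped Classical

noncomputable section

/-- Weak majorization inequality for two points and a monotone convex function. -/
lemma ConvexOn.add_le_add_of_weak_majorization {G : ℝ → ℝ} (hG : ConvexOn ℝ Set.univ G)
    (hmono : Monotone G) {x z A B : ℝ} (hx : x ≤ max A B) (hz : z ≤ max A B)
    (hadd : x + z ≤ A + B) : G x + G z ≤ G A + G B := by
  wlog hAB : B ≤ A generalizing A B
  · linarith [this (A := B) (B := A) (by rwa [max_comm]) (by rwa [max_comm]) (by linarith)
      (le_of_not_ge hAB)]
  wlog hxz : z ≤ x generalizing x z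
  · linarith [this (x := z) (z := x) hz hx (by linarith) (le_of_not_ge hxz)]
  rw [max_eq_left hAB] at hx hz
  rcases le_or_gt z B with h | h
  · exact add_le_add (hmono hx) (hmono h)
  have hA : G (x + z - B) ≤ G A := hmono (by linarith)
  have hpos : 0 < x + z - B - B := by linarith
  set c := (x - B) / (x + z - B - B) with hc
  have hc0 : 0 ≤ c := div_nonneg (by linarith) hpos.le
  have hc1 : 0 ≤ 1 - c := by
    rw [sub_nonneg, hc, div_le_one hpos]
    linarith
  have hcm : c * (x + z - B - B) = x - B := div_mul_cancel₀ _ hpos.ne'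
  have h₁ := hG.2 (Set.mem_univ (x + z - B)) (Set.mem_univ B) hc0 hc1 (by ring)
  have h₂ := hG.2 (Set.mem_univ (x + z - B)) (Set.mem_univ B) hc1 hc0 (by ring)
  simp only [smul_eq_mul] at h₁ h₂
  rw [show c * (x + z - B) + (1 - c) * B = x by linarith] at h₁
  rw [show (1 - c) * (x + z - B) + c * B = z by linarith] at h₂
  linarith

lemma bddAbove_range_of_abs_le {S : Type*} {f : S → ℝ} {C : ℝ} (hf : ∀ a, |f a| ≤ C) :
    BddAbove (Set.range f) := by
  refine ⟨C, ?_⟩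
  rintro _ ⟨a, rfl⟩
  exact (le_abs_self _).trans (hf a)

/-- Contraction in a single Rademacher variable. -/
lemma ConvexOn.map_iSup_add_map_iSup_le {S : Type*} [Nonempty S] {G : ℝ → ℝ}
    (hG : ConvexOn ℝ Set.univ G) (hmono : Monotone G) (hcont : Continuous G)
    {u v w : S → ℝ} (hvw : ∀ a, |v a| ≤ |w a|) (hlip : ∀ a b, |v a - v b| ≤ |w a - w b|)
    {C D : ℝ} (hu : ∀ a, |u a| ≤ C) (hw : ∀ a, |w a| ≤ D) :
    G (⨆ a, (u a + v a)) + G (⨆ a, (u a - v a)) ≤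
      G (⨆ a, (u a + w a)) + G (⨆ a, (u a - w a)) := by
  have bdd_add {f : S → ℝ} (hf : ∀ a, |f a| ≤ D) : BddAbove (Set.range fun a => u a + f a) :=
    bddAbove_range_of_abs_le (C := C + D) fun a =>
      (abs_add_le _ _).trans (add_le_add (hu a) (hf a))
  have bdd_sub {f : S → ℝ} (hf : ∀ a, |f a| ≤ D) : BddAbove (Set.range fun a => u a - f a) :=
    bddAbove_range_of_abs_le (C := C + D) fun a =>
      (abs_sub _ _).trans (add_le_add (hu a) (hf a))
  have hv : ∀ a, |v a| ≤ D := fun a => (hvw a).trans (hw a)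
  have pair (a b : S) : G (u a + v a) + G (u b - v b) ≤
      G (⨆ a, (u a + w a)) + G (⨆ a, (u a - w a)) := by
    have le_A (c : S) : u c + w c ≤ ⨆ a, (u a + w a) := le_ciSup (bdd_add hw) c
    have le_B (c : S) : u c - w c ≤ ⨆ a, (u a - w a) := le_ciSup (bdd_sub hw) c
    have le_max (c : S) : u c + |w c| ≤ max (⨆ a, (u a + w a)) (⨆ a, (u a - w a)) := by
      rcases abs_cases (w c) with ⟨h, -⟩ | ⟨h, -⟩ <;> rw [h]
      · exact (le_A c).trans (le_max_left _ _)
      · exact (le_B c).trans (le_max_right _ _)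
    refine hG.add_le_add_of_weak_majorization hmono ?_ ?_ ?_
    · linarith [le_max a, hvw a, le_abs_self (v a)]
    · linarith [le_max b, hvw b, neg_abs_le (v b)]
    · have h := (le_abs_self _).trans (hlip a b)
      rcases abs_cases (w a - w b) with ⟨h', -⟩ | ⟨h', -⟩ <;> rw [h'] at h
      · linarith [le_A a, le_B b]
      · linarith [le_A b, le_B a]
  rw [hmono.map_ciSup_of_continuousAt hcont.continuousAt (bdd_add hv),
    hmono.map_ciSup_of_continuousAt hcont.continuousAt (bdd_sub hv), ← le_sub_iff_add_le]
  refine ciSup_le fun a => ?_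
  rw [le_sub_iff_add_le, ← le_sub_iff_add_le']
  exact ciSup_le fun b => by linarith [pair a b]

/-- Rademacher contraction principle for suprema of bounded families. -/
lemma ConvexOn.sum_map_iSup_rademacher_le {S : Type*} [Nonempty S] {G : ℝ → ℝ}
    (hG : ConvexOn ℝ Set.univ G) (hmono : Monotone G) (hcont : Continuous G) {D : ℝ} (N : ℕ)
    (v w : Fin N → S → ℝ) (hvw : ∀ k a, |v k a| ≤ |w k a|)
    (hlip : ∀ k a b, |v k a - v k b| ≤ |w k a - w k b|) (hw : ∀ k a, |w k a| ≤ D)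
    (u : S → ℝ) (hu : ∃ C, ∀ a, |u a| ≤ C) :
    ∑ s : Fin N → Bool, G (⨆ a, (u a + ∑ k, (if s k then (1 : ℝ) else -1) * v k a)) ≤
      ∑ s : Fin N → Bool, G (⨆ a, (u a + ∑ k, (if s k then (1 : ℝ) else -1) * w k a)) := by
  induction N generalizing u with
  | zero => simp
  | succ N ih =>
    obtain ⟨C, hu⟩ := hu
    rw [← (Fin.consEquiv fun _ => Bool).sum_comp, ← (Fin.consEquiv fun _ => Bool).sum_comp,
      Fintype.sum_prod_type, Fintype.sum_prod_type]
    simp only [Fin.consEquiv_apply, Fin.sum_univ_succ, Fin.cons_zero, Fin.cons_succ]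
    calc
      _ ≤ ∑ b : Bool, ∑ s : Fin N → Bool, G (⨆ a, ((u a + (if b then (1 : ℝ) else -1) * w 0 a) +
            ∑ k, (if s k then (1 : ℝ) else -1) * v k.succ a)) := by
        rw [Fintype.sum_bool, Fintype.sum_bool, ← Finset.sum_add_distrib,
          ← Finset.sum_add_distrib]
        refine Finset.sum_le_sum fun s _ => ?_
        have hbound (a : S) : |u a + ∑ k, (if s k then (1 : ℝ) else -1) * v k.succ a| ≤
            C + ∑ _k : Fin N, D := by
          refine (abs_add_le _ _).trans (add_le_add (hu a)
            ((Finset.abs_sum_le_sum_abs _ _).trans (Finset.sum_le_sum fun k _ => ?_)))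
          rw [abs_mul, show |if s k then (1 : ℝ) else -1| = 1 by split_ifs <;> simp, one_mul]
          exact (hvw _ a).trans (hw _ a)
        simpa only [if_true, Bool.false_eq_true, if_false, one_mul, neg_one_mul, sub_eq_add_neg,
          add_assoc, add_left_comm, add_comm] using
          hG.map_iSup_add_map_iSup_le hmono hcont (hvw 0) (hlip 0) hbound (hw 0)
      _ ≤ _ := by
        refine Finset.sum_le_sum fun b _ => ?_
        simp only [← add_assoc]
        refine ih _ _ (fun k => hvw k.succ) (fun k => hlip k.succ) (fun k => hw k.succ) _
          ⟨C + D, fun a => (abs_add_le _ _).trans (add_le_add (hu a) ?_)⟩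
        rw [abs_mul, show |if b then (1 : ℝ) else -1| = 1 by split_ifs <;> simp, one_mul]
        exact hw 0 a

lemma convexOn_max_zero_pow (l : ℕ) : ConvexOn ℝ Set.univ fun x : ℝ => max x 0 ^ l :=
  ((convexOn_id convex_univ).sup (convexOn_const 0 convex_univ)).pow
    (fun _ _ => le_max_right _ _) l

lemma monotone_max_zero_pow (l : ℕ) : Monotone fun x : ℝ => max x 0 ^ l := fun _ _ h =>
  pow_le_pow_left₀ (le_max_right _ _) (max_le_max_right 0 h) l

lemma iSup_abs_pow_le {S : Type*} [Nonempty S] {f : S → ℝ} {C : ℝ} (hf : ∀ a, |f a| ≤ C)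
    (l : ℕ) : (⨆ a, |f a|) ^ l ≤ max (⨆ a, f a) 0 ^ l + max (⨆ a, -f a) 0 ^ l := by
  have h0 : 0 ≤ ⨆ a, |f a| := Real.iSup_nonneg fun _ => abs_nonneg _
  have h : ⨆ a, |f a| ≤ max (⨆ a, f a) (⨆ a, -f a) :=
    ciSup_le fun a => max_le_max (le_ciSup (bddAbove_range_of_abs_le hf) a)
      (le_ciSup (f := fun a => -f a)
        (bddAbove_range_of_abs_le (C := C) fun a => by rw [abs_neg]; exact hf a) a)
  have h₁ : 0 ≤ max (⨆ a, f a) 0 ^ l := pow_nonneg (le_max_right _ _) l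
  have h₂ : 0 ≤ max (⨆ a, -f a) 0 ^ l := pow_nonneg (le_max_right _ _) l
  rcases le_max_iff.mp h with h | h
  · linarith [pow_le_pow_left₀ h0 (h.trans (le_max_left _ 0)) l]
  · linarith [pow_le_pow_left₀ h0 (h.trans (le_max_left _ 0)) l]

/-- Rademacher contraction for moments of suprema of absolute values. -/
lemma sum_iSup_abs_rademacher_pow_le {S : Type*} [Nonempty S] {D : ℝ} {N : ℕ}
    (v w : Fin N → S → ℝ) (hvw : ∀ k a, |v k a| ≤ |w k a|)
    (hlip : ∀ k a b, |v k a - v k b| ≤ |w k a - w k b|) (hw : ∀ k a, |w k a| ≤ D) (l : ℕ) :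
    ∑ s : Fin N → Bool, (⨆ a, |∑ k, (if s k then (1 : ℝ) else -1) * v k a|) ^ l ≤
      2 * ∑ s : Fin N → Bool, (⨆ a, |∑ k, (if s k then (1 : ℝ) else -1) * w k a|) ^ l := by
  have hbound (f : Fin N → S → ℝ) (hf : ∀ k a, |f k a| ≤ D) (s : Fin N → Bool) (a : S) :
      |∑ k, (if s k then (1 : ℝ) else -1) * f k a| ≤ ∑ _k : Fin N, D := by
    refine (Finset.abs_sum_le_sum_abs _ _).trans (Finset.sum_le_sum fun k _ => ?_)
    rw [abs_mul, show |if s k then (1 : ℝ) else -1| = 1 by split_ifs <;> simp, one_mul]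
    exact hf k a
  have hv : ∀ k a, |v k a| ≤ D := fun k a => (hvw k a).trans (hw k a)
  have hflip : ∑ s : Fin N → Bool,
        max (⨆ a, -∑ k, (if s k then (1 : ℝ) else -1) * v k a) 0 ^ l =
      ∑ s : Fin N → Bool, max (⨆ a, ∑ k, (if s k then (1 : ℝ) else -1) * v k a) 0 ^ l := by
    refine Fintype.sum_equiv (Equiv.piCongrRight fun _ => Equiv.boolNot) _ _ fun s => ?_
    congr 3
    ext a
    rw [← Finset.sum_neg_distrib]
    refine Finset.sum_congr rfl fun k _ => ?_
    cases h : s k <;> simp [h]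
  have hcontr := (convexOn_max_zero_pow l).sum_map_iSup_rademacher_le (monotone_max_zero_pow l)
    (by fun_prop) N v w hvw hlip hw (fun _ => 0) ⟨0, by simp⟩
  simp only [zero_add] at hcontr
  calc
    _ ≤ ∑ s : Fin N → Bool, (max (⨆ a, ∑ k, (if s k then (1 : ℝ) else -1) * v k a) 0 ^ l +
          max (⨆ a, -∑ k, (if s k then (1 : ℝ) else -1) * v k a) 0 ^ l) :=
      Finset.sum_le_sum fun s _ => iSup_abs_pow_le (hbound v hv s) l
    _ = 2 * ∑ s : Fin N → Bool,
          max (⨆ a, ∑ k, (if s k then (1 : ℝ) else -1) * v k a) 0 ^ l := by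
      rw [Finset.sum_add_distrib, hflip, two_mul]
    _ ≤ 2 * ∑ s : Fin N → Bool,
          max (⨆ a, ∑ k, (if s k then (1 : ℝ) else -1) * w k a) 0 ^ l := by
      gcongr 2 * ?_
    _ ≤ _ := by
      gcongr 2 * ?_
      refine Finset.sum_le_sum fun s _ => pow_le_pow_left₀ (le_max_right _ _) ?_ l
      refine max_le (ciSup_le fun a => (le_abs_self _).trans ?_)
        (Real.iSup_nonneg fun _ => abs_nonneg _)
      exact le_ciSup (f := fun a => |∑ k, (if s k then (1 : ℝ) else -1) * w k a|)
        (bddAbove_range_of_abs_le fun a => by rw [abs_abs]; exact hbound w hw s a) a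

/-- Contraction: the symmetrized moment with labels is bounded by `2^(l+1)` times the
label-free Rademacher moment. -/
theorem stmt7 {n d : ℕ} (X : Matrix (Fin n) (Fin d) ℝ) (y : Fin n → ℝ) (βs : Fin d → ℝ)
    (N : ℕ) (hN : 0 < N) (p : Fin n → ℝ) (hp : ∀ i, 0 < p i)
    (hsum : (∑ i, p i) = (N : ℝ)) (l : ℕ) (hl : 1 ≤ l) :
    rexp N p (fun ι σ =>
        (⨆ β : {b : Fin d → ℝ // l1 (X.mulVec (βs - b)) = 1},
          |∑ k, σ k * (|X (ι k) ⬝ᵥ βs - y (ι k)| / p (ι k) -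
            |X (ι k) ⬝ᵥ β.1 - y (ι k)| / p (ι k))|) ^ l) ≤
      2 ^ (l + 1) * rexp N p (fun ι σ =>
        (⨆ β : {b : Fin d → ℝ // l1 (X.mulVec (βs - b)) = 1},
          |∑ k, σ k * (X (ι k) ⬝ᵥ (βs - β.1)) / p (ι k)|) ^ l) := by
  rcases isEmpty_or_nonempty {b : Fin d → ℝ // l1 (X.mulVec (βs - b)) = 1} with hS | hS
  · simp [rexp, Real.iSup_of_isEmpty, Nat.one_le_iff_ne_zero.mp hl]
  unfold rexp
  rw [Finset.mul_sum]
  refine Finset.sum_le_sum fun ι _ => ?_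
  have hweight : 0 ≤ (∏ k, p (ι k) / N) * (1 / 2 : ℝ) ^ N :=
    mul_nonneg (Finset.prod_nonneg fun k _ => div_nonneg (hp _).le N.cast_nonneg) (by positivity)
  rw [← Finset.mul_sum, ← Finset.mul_sum, mul_left_comm]
  refine mul_le_mul_of_nonneg_left ?_ hweight
  have hentry (b : {b : Fin d → ℝ // l1 (X.mulVec (βs - b)) = 1}) (i : Fin n) :
      |X i ⬝ᵥ (βs - b.1)| ≤ 1 :=
    (Finset.single_le_sum (f := fun i => |X.mulVec (βs - b.1) i|)
      (fun _ _ => abs_nonneg _) (Finset.mem_univ i)).trans_eq b.2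
  have key := sum_iSup_abs_rademacher_pow_le (D := ∑ i, 1 / p i)
    (fun k (β : {b : Fin d → ℝ // l1 (X.mulVec (βs - b)) = 1}) =>
      |X (ι k) ⬝ᵥ βs - y (ι k)| / p (ι k) - |X (ι k) ⬝ᵥ β.1 - y (ι k)| / p (ι k))
    (fun k β => (X (ι k) ⬝ᵥ (βs - β.1)) / p (ι k))
    (fun k a => by
      rw [← sub_div, abs_div, abs_div, dotProduct_sub]
      refine div_le_div_of_nonneg_right ((abs_abs_sub_abs_le_abs_sub _ _).trans_eq ?_)
        (abs_nonneg _)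
      congr 1
      ring)
    (fun k a b => by
      rw [← sub_div, ← sub_div, ← sub_div, ← sub_div, abs_div, abs_div, dotProduct_sub,
        dotProduct_sub, sub_sub_sub_cancel_left, sub_sub_sub_cancel_left]
      refine div_le_div_of_nonneg_right ((abs_abs_sub_abs_le_abs_sub _ _).trans_eq ?_)
        (abs_nonneg _)
      congr 1
      ring)
    (fun k a => by
      rw [abs_div, abs_of_pos (hp _)]
      exact (div_le_div_of_nonneg_right (hentry a _) (hp _).le).trans
        (Finset.single_le_sum (f := fun i => 1 / p i)
          (fun i _ => (one_div_pos.mpr (hp i)).le) (Finset.mem_univ (ι k)))) l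
  simp only [mul_div_assoc]
  refine key.trans (mul_le_mul_of_nonneg_right ?_ (Finset.sum_nonneg fun s _ =>
    pow_nonneg (Real.iSup_nonneg fun _ => abs_nonneg _) l))
  exact le_self_pow₀ one_le_two l.succ_ne_zero
end
end

section
/- There exist absolute constants C, C₁, C₄ > 0 and ε₀, δ₀ ∈ (0,1) with the following property. Let ε ∈ (0,ε₀), δ ∈ (0,δ₀), let X ∈ ℝ^{n×d} have rows x_1,…,x_n and ℓ1 Lewis weights w_1,…,w_n, let N be a positive integer with N ≥ C₄·(d/ε²)·log(d/(εδ)), and let p_1,…,p_n be positive reals with Σ_{i=1}^n p_i = N and p_i ≥ (log((N + C₁·N·d)/δ)/(C·ε²))·w_i for every i. Set l = ⌈log₂(2(N + C₁·N·d)/δ)⌉. Let i_1,…,i_N ∈ {1,…,n} be i.i.d. with P(i_k = i) = p_i/N and let σ_1,…,σ_N be independent uniform ±1 random variables, independent of the indices. Then E[ ( sup over β ∈ ℝ^d with ‖Xβ‖₁ = 1 of | Σ_{k=1}^N σ_k·(x_{i_k}ᵀβ)/p_{i_k} | )^l ] ≤ ε^l·δ/2. -/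
open Finset Matrix
open scoped Classical

noncomputable section

/-- Reconstruction of a pairing from the Lewis quadratic form. -/
lemma IsLewisWeights.dotProduct_eq {n d : ℕ} {X : Matrix (Fin n) (Fin d) ℝ} {w : Fin n → ℝ}
    (hw : IsLewisWeights X w) (v b : Fin d → ℝ) :
    v ⬝ᵥ b = ∑ j, (w j)⁻¹ * ((X j ⬝ᵥ (lewisMatrix X w)⁻¹ *ᵥ v) * (X j ⬝ᵥ b)) := by
  have hdet : IsUnit (lewisMatrix X w).det := (Matrix.isUnit_iff_isUnit_det _).1 hw.2.1
  set c := (lewisMatrix X w)⁻¹ *ᵥ v with hc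
  have hv : v = lewisMatrix X w *ᵥ c := by
    rw [hc, Matrix.mulVec_mulVec, Matrix.mul_nonsing_inv _ hdet, Matrix.one_mulVec]
  rw [hv, lewisMatrix, Matrix.sum_mulVec, sum_dotProduct]
  refine Finset.sum_congr rfl fun j _ => ?_
  rw [Matrix.smul_mulVec, smul_dotProduct, Matrix.vecMulVec_mulVec]
  simp [dotProduct_comm]

/-- The Gram matrix of the rows with respect to the inverse Lewis quadratic form. -/
def lewisGram {n d : ℕ} (X : Matrix (Fin n) (Fin d) ℝ) (w : Fin n → ℝ) (i j : Fin n) : ℝ :=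
  X i ⬝ᵥ (lewisMatrix X w)⁻¹ *ᵥ X j

lemma IsLewisWeights.sum_lewisGram_mul {n d : ℕ} {X : Matrix (Fin n) (Fin d) ℝ} {w : Fin n → ℝ}
    (hw : IsLewisWeights X w) (i j : Fin n) :
    ∑ m, (w m)⁻¹ * (lewisGram X w m i * lewisGram X w m j) = lewisGram X w i j :=
  (hw.dotProduct_eq (X i) _).symm

lemma IsLewisWeights.sum_lewisGram_sq {n d : ℕ} {X : Matrix (Fin n) (Fin d) ℝ} {w : Fin n → ℝ}
    (hw : IsLewisWeights X w) (j : Fin n) :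
    ∑ m, (w m)⁻¹ * lewisGram X w m j ^ 2 = w j ^ 2 := by
  simp_rw [pow_two (lewisGram X w _ j)]
  rw [hw.sum_lewisGram_mul, hw.2.2 j, lewisGram]

lemma IsLewisWeights.lewisGram_comm {n d : ℕ} {X : Matrix (Fin n) (Fin d) ℝ} {w : Fin n → ℝ}
    (hw : IsLewisWeights X w) (i j : Fin n) : lewisGram X w i j = lewisGram X w j i := by
  rw [← hw.sum_lewisGram_mul i j, ← hw.sum_lewisGram_mul j i]
  simp_rw [mul_comm (lewisGram X w _ i)]

lemma weighted_cauchy_schwarz {n : ℕ} {w : Fin n → ℝ} (hw : ∀ i, 0 < w i) (f g : Fin n → ℝ) :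
    (∑ m, (w m)⁻¹ * (f m * g m)) ^ 2 ≤ (∑ m, (w m)⁻¹ * f m ^ 2) * ∑ m, (w m)⁻¹ * g m ^ 2 := by
  have hp : ∀ m, 0 < (w m)⁻¹ := fun m => inv_pos.2 (hw m)
  refine Finset.sum_sq_le_sum_mul_sum_of_sq_le_mul _
    (fun m _ => mul_nonneg (hp m).le (sq_nonneg _))
    (fun m _ => mul_nonneg (hp m).le (sq_nonneg _)) fun m _ => le_of_eq (by ring)

lemma IsLewisWeights.abs_lewisGram_le {n d : ℕ} {X : Matrix (Fin n) (Fin d) ℝ} {w : Fin n → ℝ}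
    (hw : IsLewisWeights X w) (i j : Fin n) : |lewisGram X w i j| ≤ w i * w j := by
  refine abs_le_of_sq_le_sq ?_ (mul_nonneg (hw.1 i).le (hw.1 j).le)
  have h := weighted_cauchy_schwarz hw.1 (lewisGram X w · i) (lewisGram X w · j)
  rwa [hw.sum_lewisGram_mul, hw.sum_lewisGram_sq, hw.sum_lewisGram_sq, ← mul_pow] at h

lemma IsLewisWeights.abs_dotProduct_le {n d : ℕ} {X : Matrix (Fin n) (Fin d) ℝ} {w : Fin n → ℝ}
    (hw : IsLewisWeights X w) {b : Fin d → ℝ} (hb : l1 (X.mulVec b) = 1) (j : Fin n) :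
    |X j ⬝ᵥ b| ≤ w j := by
  set Q := ∑ m, (w m)⁻¹ * (X m ⬝ᵥ b) ^ 2 with hQ
  have hQ0 : 0 ≤ Q := Finset.sum_nonneg fun m _ =>
    mul_nonneg (inv_pos.2 (hw.1 m)).le (sq_nonneg _)
  have hle : ∀ i, |X i ⬝ᵥ b| ≤ w i * √Q := by
    intro i
    refine abs_le_of_sq_le_sq ?_ (mul_nonneg (hw.1 i).le (Real.sqrt_nonneg _))
    have h := weighted_cauchy_schwarz hw.1 (lewisGram X w · i) (X · ⬝ᵥ b)
    rw [hw.sum_lewisGram_sq] at h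
    rw [mul_pow, Real.sq_sqrt hQ0]
    refine le_trans (le_of_eq ?_) h
    rw [hw.dotProduct_eq (X i) b]
    rfl
  have hQle : Q ≤ √Q := by
    calc Q ≤ ∑ m, √Q * |X m ⬝ᵥ b| := by
          refine Finset.sum_le_sum fun m _ => ?_
          rw [inv_mul_le_iff₀ (hw.1 m), ← sq_abs, pow_two, ← mul_assoc]
          exact mul_le_mul_of_nonneg_right (hle m) (abs_nonneg _)
      _ = √Q := by
          rw [← Finset.mul_sum]
          have : ∑ m, |X m ⬝ᵥ b| = 1 := hb
          rw [this, mul_one]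
  have hs : √Q ≤ 1 := by
    nlinarith [Real.sq_sqrt hQ0, Real.sqrt_nonneg Q]
  exact (hle j).trans (mul_le_of_le_one_right (hw.1 j).le hs)

lemma IsLewisWeights.sum_eq {n d : ℕ} {X : Matrix (Fin n) (Fin d) ℝ} {w : Fin n → ℝ}
    (hw : IsLewisWeights X w) : ∑ j, w j = d := by
  have hdet : IsUnit (lewisMatrix X w).det := (Matrix.isUnit_iff_isUnit_det _).1 hw.2.1
  have h1 : (lewisMatrix X w * (lewisMatrix X w)⁻¹).trace = d := by
    rw [Matrix.mul_nonsing_inv _ hdet, Matrix.trace_one, Fintype.card_fin]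
  rw [← h1]
  conv_rhs => enter [1, 1]; rw [lewisMatrix]
  rw [Finset.sum_mul, Matrix.trace_sum]
  refine Finset.sum_congr rfl fun j _ => ?_
  rw [Matrix.smul_mul, Matrix.trace_smul, Matrix.vecMulVec_mul, Matrix.trace_vecMulVec,
    dotProduct_comm, ← Matrix.dotProduct_mulVec, ← hw.2.2 j, smul_eq_mul]
  have := (hw.1 j).ne'
  field_simp

/-- The dual norm of `‖X ·‖₁`, raised to a power, is controlled by a Lewis-weighted average. -/
lemma IsLewisWeights.iSup_pow_le {n d N : ℕ} {X : Matrix (Fin n) (Fin d) ℝ} {w : Fin n → ℝ}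
    (hw : IsLewisWeights X w) (p : Fin n → ℝ) (ι : Fin N → Fin n) (σ : Fin N → ℝ)
    {l : ℕ} (hl : l ≠ 0) :
    (⨆ β : {b : Fin d → ℝ // l1 (X.mulVec b) = 1},
        |∑ k, σ k * (X (ι k) ⬝ᵥ β.1) / p (ι k)|) ^ l ≤
      ∑ j, w j * |∑ k, σ k * (lewisGram X w j (ι k) / (w j * p (ι k)))| ^ l := by
  set T : Fin n → ℝ := fun j => ∑ k, σ k * (lewisGram X w j (ι k) / (w j * p (ι k))) with hT
  have hR : 0 ≤ ∑ j, w j * |T j| ^ l :=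
    Finset.sum_nonneg fun j _ => mul_nonneg (hw.1 j).le (pow_nonneg (abs_nonneg _) _)
  have key : ∀ β : {b : Fin d → ℝ // l1 (X.mulVec b) = 1},
      |∑ k, σ k * (X (ι k) ⬝ᵥ β.1) / p (ι k)| ^ l ≤ ∑ j, w j * |T j| ^ l := by
    rintro ⟨b, hb⟩
    have h1 : ∑ j, |X j ⬝ᵥ b| = 1 := hb
    have hrep : ∑ k, σ k * (X (ι k) ⬝ᵥ b) / p (ι k) = ∑ j, (X j ⬝ᵥ b) * T j := by
      simp_rw [hT, Finset.mul_sum]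
      rw [Finset.sum_comm]
      refine Finset.sum_congr rfl fun k _ => ?_
      rw [hw.dotProduct_eq (X (ι k)) b, Finset.mul_sum, Finset.sum_div]
      refine Finset.sum_congr rfl fun j _ => ?_
      rw [lewisGram]
      simp only [div_eq_mul_inv, mul_inv]
      ring
    have habs : |∑ k, σ k * (X (ι k) ⬝ᵥ b) / p (ι k)| ≤ ∑ j, |X j ⬝ᵥ b| * |T j| := by
      rw [hrep]
      refine (Finset.abs_sum_le_sum_abs _ _).trans (le_of_eq ?_)
      simp_rw [abs_mul]
    calc |∑ k, σ k * (X (ι k) ⬝ᵥ b) / p (ι k)| ^ l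
        ≤ (∑ j, |X j ⬝ᵥ b| * |T j|) ^ l := pow_le_pow_left₀ (abs_nonneg _) habs l
      _ ≤ ∑ j, |X j ⬝ᵥ b| * |T j| ^ l :=
          Real.pow_arith_mean_le_arith_mean_pow _ _ _ (fun _ _ => abs_nonneg _) h1
            (fun _ _ => abs_nonneg _) l
      _ ≤ ∑ j, w j * |T j| ^ l := Finset.sum_le_sum fun j _ =>
          mul_le_mul_of_nonneg_right (hw.abs_dotProduct_le hb j) (pow_nonneg (abs_nonneg _) _)
  have hroot : ((∑ j, w j * |T j| ^ l) ^ ((l : ℝ)⁻¹)) ^ l = ∑ j, w j * |T j| ^ l :=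
    Real.rpow_inv_natCast_pow hR hl
  rw [← hroot]
  refine pow_le_pow_left₀ (Real.iSup_nonneg fun _ => abs_nonneg _) ?_ l
  refine Real.iSup_le (fun β => ?_) (Real.rpow_nonneg hR _)
  refine le_of_pow_le_pow_left₀ hl (Real.rpow_nonneg hR _) ?_
  rw [hroot]
  exact key β

lemma rexp_mono {n N : ℕ} {p : Fin n → ℝ} (hp : ∀ i, 0 < p i)
    {f g : (Fin N → Fin n) → (Fin N → ℝ) → ℝ} (h : ∀ ι σ, f ι σ ≤ g ι σ) :
    rexp N p f ≤ rexp N p g := by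
  refine Finset.sum_le_sum fun ι _ => Finset.sum_le_sum fun s _ => ?_
  refine mul_le_mul_of_nonneg_left (h _ _) (mul_nonneg ?_ (by positivity))
  exact Finset.prod_nonneg fun k _ => div_nonneg (hp _).le (Nat.cast_nonneg _)

lemma rexp_sum_mul {n N m : ℕ} (p : Fin n → ℝ) (c : Fin m → ℝ)
    (f : Fin m → (Fin N → Fin n) → (Fin N → ℝ) → ℝ) :
    rexp N p (fun ι σ => ∑ j, c j * f j ι σ) = ∑ j, c j * rexp N p (f j) := by
  simp only [rexp, Finset.mul_sum]
  rw [Finset.sum_comm]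
  conv_rhs => rw [Finset.sum_comm]
  rw [Finset.sum_comm]
  refine Finset.sum_congr rfl fun ι _ => ?_
  rw [Finset.sum_comm]
  exact Finset.sum_congr rfl fun j _ => Finset.sum_congr rfl fun s _ => by ring

lemma rexp_add {n N : ℕ} (p : Fin n → ℝ) (f g : (Fin N → Fin n) → (Fin N → ℝ) → ℝ) :
    rexp N p (fun ι σ => f ι σ + g ι σ) = rexp N p f + rexp N p g := by
  simp only [rexp, mul_add, Finset.sum_add_distrib]

lemma rexp_const_mul {n N : ℕ} (p : Fin n → ℝ) (c : ℝ)
    (f : (Fin N → Fin n) → (Fin N → ℝ) → ℝ) :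
    rexp N p (fun ι σ => c * f ι σ) = c * rexp N p f := by
  simp only [rexp, Finset.mul_sum]
  exact Finset.sum_congr rfl fun ι _ => Finset.sum_congr rfl fun s _ => by ring

/-- The moment generating function of the sampled Rademacher sum factorizes. -/
lemma rexp_exp_sum {n N : ℕ} (p a : Fin n → ℝ) :
    rexp N p (fun ι σ => Real.exp (∑ k, σ k * a (ι k))) =
      (∑ i, p i / N * Real.cosh (a i)) ^ N := by
  rw [Fintype.sum_pow, rexp]
  refine Finset.sum_congr rfl fun ι _ => ?_
  have hcosh : ∀ x : ℝ, Real.cosh x =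
      ∑ s : Bool, (1 / 2 : ℝ) * Real.exp ((if s then 1 else -1) * x) := by
    intro x
    rw [Real.cosh_eq]
    simp
    ring
  rw [Finset.prod_mul_distrib]
  simp_rw [hcosh]
  rw [Finset.prod_univ_sum, Fintype.piFinset_univ, Finset.mul_sum]
  refine Finset.sum_congr rfl fun s _ => ?_
  rw [Real.exp_sum, Finset.prod_mul_distrib]
  simp [mul_assoc]

lemma cosh_le_one_add_sq {x : ℝ} (hx : |x| ≤ 1) : Real.cosh x ≤ 1 + x ^ 2 := by
  have h1 := (abs_le.1 (Real.abs_exp_sub_one_sub_id_le hx)).2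
  have h2 := (abs_le.1 (Real.abs_exp_sub_one_sub_id_le (x := -x) (by rwa [abs_neg]))).2
  rw [Real.cosh_eq]
  nlinarith

lemma rexp_exp_sum_le {n N : ℕ} (hN : 0 < N) {p a : Fin n → ℝ} (hp : ∀ i, 0 < p i)
    (hsum : ∑ i, p i = N) (ha : ∀ i, |a i| ≤ 1) :
    rexp N p (fun ι σ => Real.exp (∑ k, σ k * a (ι k))) ≤ Real.exp (∑ i, p i * a i ^ 2) := by
  have hN' : (0 : ℝ) < N := Nat.cast_pos.2 hN
  rw [rexp_exp_sum]
  have h1 : ∑ i, p i / N * Real.cosh (a i) ≤ Real.exp ((∑ i, p i * a i ^ 2) / N) := by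
    calc ∑ i, p i / N * Real.cosh (a i) ≤ ∑ i, p i / N * (1 + a i ^ 2) :=
          Finset.sum_le_sum fun i _ => mul_le_mul_of_nonneg_left (cosh_le_one_add_sq (ha i))
            (div_nonneg (hp i).le hN'.le)
      _ = (∑ i, p i * a i ^ 2) / N + 1 := by
          simp_rw [mul_add, Finset.sum_add_distrib, mul_one]
          rw [← Finset.sum_div, hsum, div_self hN'.ne', Finset.sum_div, add_comm]
          congr 1
          exact Finset.sum_congr rfl fun i _ => by ring
      _ ≤ _ := Real.add_one_le_exp _
  refine (pow_le_pow_left₀ (Finset.sum_nonneg fun i _ => mul_nonneg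
    (div_nonneg (hp i).le hN'.le) (Real.cosh_pos _).le) h1 N).trans (le_of_eq ?_)
  rw [← Real.exp_nat_mul, mul_div_cancel₀ _ hN'.ne']

/-- Moments of a sampled Rademacher sum, from its exponential moments. -/
lemma rexp_abs_pow_le {n N : ℕ} (hN : 0 < N) {p a : Fin n → ℝ} (hp : ∀ i, 0 < p i)
    (hsum : ∑ i, p i = N) {t : ℝ} (ht : 0 < t) (ha : ∀ i, t * |a i| ≤ 1) (l : ℕ) :
    rexp N p (fun ι σ => |∑ k, σ k * a (ι k)| ^ l) ≤
      2 * (l / t) ^ l * Real.exp (t ^ 2 * ∑ i, p i * a i ^ 2) := by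
  have hpt : ∀ x : ℝ, |x| ^ l ≤ (l / t) ^ l * (Real.exp (t * x) + Real.exp (-(t * x))) := by
    intro x
    have h1 : (t * |x|) ^ l / l.factorial ≤ Real.exp (t * |x|) :=
      Real.pow_div_factorial_le_exp _ (by positivity) l
    have h2 : Real.exp (t * |x|) ≤ Real.exp (t * x) + Real.exp (-(t * x)) := by
      rcases abs_cases x with ⟨h, _⟩ | ⟨h, _⟩ <;> rw [h]
      · linarith [Real.exp_pos (-(t * x))]
      · rw [mul_neg]
        linarith [Real.exp_pos (t * x)]
    have h3 : (l.factorial : ℝ) ≤ (l : ℝ) ^ l := by exact_mod_cast Nat.factorial_le_pow l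
    rw [div_le_iff₀ (by positivity), mul_pow] at h1
    rw [div_pow, div_mul_eq_mul_div, le_div_iff₀ (by positivity)]
    calc |x| ^ l * t ^ l ≤ Real.exp (t * |x|) * l.factorial := by linarith
      _ ≤ (Real.exp (t * x) + Real.exp (-(t * x))) * (l : ℝ) ^ l := by gcongr
      _ = _ := mul_comm _ _
  have hpos := rexp_exp_sum_le (a := fun i => t * a i) hN hp hsum
    (fun i => by rw [abs_mul, abs_of_pos ht]; exact ha i)
  have hneg := rexp_exp_sum_le (a := fun i => -(t * a i)) hN hp hsum
    (fun i => by rw [abs_neg, abs_mul, abs_of_pos ht]; exact ha i)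
  have hvar : ∑ i, p i * (t * a i) ^ 2 = t ^ 2 * ∑ i, p i * a i ^ 2 := by
    rw [Finset.mul_sum]
    exact Finset.sum_congr rfl fun i _ => by ring
  simp_rw [neg_sq, hvar] at hpos hneg
  have hle := rexp_mono hp (N := N)
    (f := fun ι σ => |∑ k, σ k * a (ι k)| ^ l)
    (g := fun ι σ => (l / t) ^ l * (Real.exp (∑ k, σ k * (t * a (ι k))) +
      Real.exp (∑ k, σ k * -(t * a (ι k))))) (fun ι σ => by
      refine (hpt _).trans (le_of_eq ?_)
      simp only [Finset.mul_sum, mul_neg, Finset.sum_neg_distrib, mul_left_comm t])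
  rw [rexp_const_mul, rexp_add] at hle
  have hc : 0 ≤ ((l : ℝ) / t) ^ l := by positivity
  nlinarith

/-- Moment bound at order `l` when the sampling rates dominate the Lewis weights by a factor
of order `l / ε ^ 2`. -/
lemma IsLewisWeights.rexp_gram_pow_le {n d N : ℕ} (hN : 0 < N) {X : Matrix (Fin n) (Fin d) ℝ}
    {w p : Fin n → ℝ} (hw : IsLewisWeights X w) (hp : ∀ i, 0 < p i) (hsum : ∑ i, p i = N)
    {ε : ℝ} (hε : 0 < ε) (hε1 : ε < 1) {l : ℕ} (hl : l ≠ 0)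
    (hdom : ∀ i, 256 * l / ε ^ 2 * w i ≤ p i) (j : Fin n) :
    rexp N p (fun ι σ => |∑ k, σ k * (lewisGram X w j (ι k) / (w j * p (ι k)))| ^ l) ≤
      (ε / 2) ^ l := by
  have hl' : (0 : ℝ) < l := Nat.cast_pos.2 (Nat.pos_of_ne_zero hl)
  set a : Fin n → ℝ := fun i => lewisGram X w j i / (w j * p i) with ha
  have hwp : ∀ i, w i / p i ≤ ε ^ 2 / (256 * l) := fun i => by
    have := hdom i
    rw [div_mul_eq_mul_div, div_le_iff₀ (by positivity)] at this
    rw [div_le_div_iff₀ (hp i) (by positivity)]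
    linarith
  have habs : ∀ i, |a i| ≤ w i / p i := fun i => by
    rw [ha, abs_div, abs_of_pos (mul_pos (hw.1 j) (hp i)),
      div_le_div_iff₀ (mul_pos (hw.1 j) (hp i)) (hp i)]
    nlinarith [hw.abs_lewisGram_le j i, hp i]
  have hvar : ∑ i, p i * a i ^ 2 ≤ ε ^ 2 / (256 * l) := by
    have hj := hw.1 j
    calc ∑ i, p i * a i ^ 2
        = ∑ i, (w i / p i) * ((w i)⁻¹ * lewisGram X w i j ^ 2 / w j ^ 2) := by
          refine Finset.sum_congr rfl fun i _ => ?_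
          have h1 := (hw.1 i).ne'
          have h2 := (hp i).ne'
          rw [ha, hw.lewisGram_comm i j]
          field_simp
      _ ≤ ∑ i, ε ^ 2 / (256 * l) * ((w i)⁻¹ * lewisGram X w i j ^ 2 / w j ^ 2) := by
          refine Finset.sum_le_sum fun i _ => mul_le_mul_of_nonneg_right (hwp i) ?_
          have := hw.1 i
          positivity
      _ = ε ^ 2 / (256 * l) := by
          rw [← Finset.mul_sum, ← Finset.sum_div, hw.sum_lewisGram_sq, div_self (by positivity),
            mul_one]
  have ht : 0 < 16 * (l : ℝ) / ε := by positivity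
  have hmain := rexp_abs_pow_le hN hp hsum (a := a) ht (fun i => by
    calc 16 * (l : ℝ) / ε * |a i| ≤ 16 * (l : ℝ) / ε * (ε ^ 2 / (256 * l)) :=
          mul_le_mul_of_nonneg_left ((habs i).trans (hwp i)) ht.le
      _ = ε / 16 := by field_simp; norm_num
      _ ≤ 1 := by linarith) l
  refine hmain.trans ?_
  have he : (16 * (l : ℝ) / ε) ^ 2 * ∑ i, p i * a i ^ 2 ≤ l := by
    calc (16 * (l : ℝ) / ε) ^ 2 * ∑ i, p i * a i ^ 2
        ≤ (16 * (l : ℝ) / ε) ^ 2 * (ε ^ 2 / (256 * l)) := by gcongr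
      _ = (l : ℝ) := by field_simp; norm_num
  have he2 : Real.exp ((16 * (l : ℝ) / ε) ^ 2 * ∑ i, p i * a i ^ 2) ≤ 3 ^ l := by
    refine (Real.exp_le_exp.2 he).trans ?_
    rw [← Real.exp_one_pow]
    exact pow_le_pow_left₀ (Real.exp_pos _).le Real.exp_one_lt_three.le l
  have hb : (l : ℝ) / (16 * l / ε) = ε / 16 := by field_simp
  have h2 : (2 : ℝ) ≤ 2 ^ l := by
    simpa using pow_le_pow_right₀ (one_le_two (α := ℝ)) (Nat.one_le_iff_ne_zero.2 hl)
  rw [hb]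
  calc 2 * (ε / 16) ^ l * Real.exp ((16 * (l : ℝ) / ε) ^ 2 * ∑ i, p i * a i ^ 2)
      ≤ 2 ^ l * (ε / 16) ^ l * 3 ^ l := by gcongr
    _ = (2 * (ε / 16) * 3) ^ l := by rw [mul_pow, mul_pow]
    _ ≤ (ε / 2) ^ l := pow_le_pow_left₀ (by positivity) (by linarith) l

/-- High-probability moment bound for the label-free Rademacher process under Lewis-weight
dominated sampling. -/
theorem stmt8 :
    ∃ C C₁ C₄ ε₀ δ₀ : ℝ, 0 < C ∧ 0 < C₁ ∧ 0 < C₄ ∧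
      0 < ε₀ ∧ ε₀ < 1 ∧ 0 < δ₀ ∧ δ₀ < 1 ∧
      ∀ (ε δ : ℝ), 0 < ε → ε < ε₀ → 0 < δ → δ < δ₀ →
        ∀ (n d : ℕ) (X : Matrix (Fin n) (Fin d) ℝ) (w : Fin n → ℝ),
          IsLewisWeights X w →
          ∀ N : ℕ, 0 < N →
            C₄ * ((d : ℝ) / ε ^ 2) * Real.log ((d : ℝ) / (ε * δ)) ≤ (N : ℝ) →
            ∀ p : Fin n → ℝ, (∀ i, 0 < p i) → (∑ i, p i) = (N : ℝ) →
              (∀ i, Real.log (((N : ℝ) + C₁ * N * d) / δ) / (C * ε ^ 2) * w i ≤ p i) →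
              rexp N p (fun ι σ =>
                  (⨆ β : {b : Fin d → ℝ // l1 (X.mulVec b) = 1},
                    |∑ k, σ k * (X (ι k) ⬝ᵥ β.1) / p (ι k)|) ^
                    ⌈Real.logb 2 (2 * ((N : ℝ) + C₁ * N * d) / δ)⌉₊) ≤
                ε ^ ⌈Real.logb 2 (2 * ((N : ℝ) + C₁ * N * d) / δ)⌉₊ * δ / 2 := by
  refine ⟨1 / 1024, 1, 1, 1 / 2, 1 / 4, by norm_num, by norm_num, by norm_num, by norm_num,
    by norm_num, by norm_num, by norm_num, ?_⟩
  intro ε δ hε hε1 hδ hδ1 n d X w hw N hN _ p hp hsum hdom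
  set M : ℝ := (N : ℝ) + 1 * N * d with hM
  set l : ℕ := ⌈Real.logb 2 (2 * M / δ)⌉₊ with hl
  have hN1 : (1 : ℝ) ≤ N := by exact_mod_cast hN
  have hd0 : (0 : ℝ) ≤ d := Nat.cast_nonneg d
  have hM1 : 1 ≤ M := by nlinarith
  have hMd : (d : ℝ) ≤ M := by nlinarith
  have hMδ : 4 ≤ M / δ := by
    rw [le_div_iff₀ hδ]
    linarith
  have hpow : 2 * M / δ ≤ 2 ^ l := by
    have h := Nat.le_ceil (Real.logb 2 (2 * M / δ))
    rwa [Real.logb_le_iff_le_rpow one_lt_two (by positivity), Real.rpow_natCast] at h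
  have hlog2 : (0.69 : ℝ) < Real.log 2 := by linarith [Real.log_two_gt_d9]
  have hlog : 2 * Real.log 2 ≤ Real.log (M / δ) := by
    have h := Real.log_le_log (by norm_num) hMδ
    rwa [show (4 : ℝ) = 2 ^ 2 by norm_num, Real.log_pow, Nat.cast_ofNat] at h
  have hsplit : Real.logb 2 (2 * M / δ) = 1 + Real.log (M / δ) / Real.log 2 := by
    rw [mul_div_assoc, Real.logb, Real.log_mul two_ne_zero (by positivity), add_div,
      div_self (by linarith)]
  have hratio : 0 ≤ Real.log (M / δ) / Real.log 2 := div_nonneg (by linarith) (by linarith)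
  have hl0 : l ≠ 0 := (Nat.ceil_pos.2 (by rw [hsplit]; linarith)).ne'
  have hlle : (l : ℝ) ≤ 4 * Real.log (M / δ) := by
    have h := Nat.ceil_lt_add_one (a := Real.logb 2 (2 * M / δ)) (by rw [hsplit]; linarith)
    rw [← hl] at h
    have h2 : 2 + Real.log (M / δ) / Real.log 2 ≤ 4 * Real.log (M / δ) := by
      have h3 : Real.log (M / δ) / Real.log 2 ≤ 1.5 * Real.log (M / δ) := by
        rw [div_le_iff₀ (by linarith)]
        nlinarith
      linarith
    linarith
  have hdom' : ∀ i, 256 * l / ε ^ 2 * w i ≤ p i := fun i => by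
    refine le_trans (mul_le_mul_of_nonneg_right ?_ (hw.1 i).le) (hdom i)
    rw [div_le_div_iff₀ (by positivity) (by positivity)]
    nlinarith [pow_pos hε 2]
  refine (rexp_mono hp fun ι σ => hw.iSup_pow_le p ι σ hl0).trans ?_
  rw [rexp_sum_mul p w fun j ι σ =>
    |∑ k, σ k * (lewisGram X w j (ι k) / (w j * p (ι k)))| ^ l]
  calc ∑ j, w j * rexp N p (fun ι σ =>
          |∑ k, σ k * (lewisGram X w j (ι k) / (w j * p (ι k)))| ^ l)
      ≤ ∑ j, w j * (ε / 2) ^ l := Finset.sum_le_sum fun j _ => mul_le_mul_of_nonneg_left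
        (hw.rexp_gram_pow_le hN hp hsum hε (by linarith) hl0 hdom' j) (hw.1 j).le
    _ = ε ^ l * (d / 2 ^ l) := by
        rw [← Finset.sum_mul, hw.sum_eq, div_pow]
        ring
    _ ≤ ε ^ l * (δ / 2) := by
        refine mul_le_mul_of_nonneg_left ?_ (by positivity)
        rw [div_le_iff₀ hδ] at hpow
        rw [div_le_div_iff₀ (by positivity) two_pos]
        linarith
    _ = ε ^ l * δ / 2 := by ring
end
end

section
/- Let d be a positive integer and 0 < ε < 1/2. For β* ∈ {−1,1}^d define the loss l_{β*}(β) = (1/d)·Σ_{i=1}^d [ (1/2+ε)·|β_i − β*_i| + (1/2−ε)·|β_i + β*_i| ], which is the expected absolute error E|Xᵀβ − Y| when X is uniform over the standard basis vectors of ℝ^d and Y = Z·(Xᵀβ*) with Z independent, equal to 1 with probability 1/2+ε and −1 with probability 1/2−ε. Let 𝟙 ∈ ℝ^d denote the all-ones vector. Then for every β ∈ ℝ^d, max{ l_{−𝟙}(β) − l_{−𝟙}(−𝟙), l_{𝟙}(β) − l_{𝟙}(𝟙) } ≥ 2ε. -/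
open Finset

noncomputable section

/-- The expected absolute error `E|Xᵀβ − Y|` when `X` is uniform over the standard basis
vectors of `ℝ^d` and `Y = Z·(Xᵀβ*)` with `Z` independent, `1` with probability `1/2 + ε`
and `−1` with probability `1/2 − ε`. -/
def loss (d : ℕ) (ε : ℝ) (βs β : Fin d → ℝ) : ℝ :=
  (1 / d) * ∑ i, ((1 / 2 + ε) * |β i - βs i| + (1 / 2 - ε) * |β i + βs i|)

/-- The loss of `β*` itself, when `β*` is a constant sign vector. -/
lemma loss_self_const {d : ℕ} (hd : 0 < d) (ε : ℝ) {s : ℝ} (hs : |s| = 1) :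
    loss d ε (fun _ => s) (fun _ => s) = 1 - 2 * ε := by
  have hd' : (d : ℝ) ≠ 0 := by positivity
  have h : |s + s| = 2 := by rw [← two_mul, abs_mul, hs]; norm_num
  simp only [loss, sub_self, abs_zero, h, sum_const, card_univ, Fintype.card_fin, nsmul_eq_mul]
  field_simp
  ring

/-- The losses relative to `−𝟙` and `𝟙` sum to at least `2`. -/
lemma two_le_loss_neg_one_add_loss_one {d : ℕ} (hd : 0 < d) (ε : ℝ) (β : Fin d → ℝ) :
    2 ≤ loss d ε (fun _ => -1) β + loss d ε (fun _ => 1) β := by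
  have hd' : (0 : ℝ) < d := by positivity
  have hsum : (d : ℝ) * 2 ≤ ∑ i, (|β i - 1| + |β i + 1|) := by
    have h := card_nsmul_le_sum univ (fun i => |β i - 1| + |β i + 1|) 2 fun i _ => by
      linarith [neg_le_abs (β i - 1), le_abs_self (β i + 1)]
    simpa using h
  have hloss : loss d ε (fun _ => -1) β + loss d ε (fun _ => 1) β =
      (1 / d) * ∑ i, (|β i - 1| + |β i + 1|) := by
    simp only [loss, ← mul_add, ← sum_add_distrib]
    congr 1
    refine sum_congr rfl fun i _ => ?_
    rw [sub_neg_eq_add, ← sub_eq_add_neg]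
    ring
  rw [hloss, one_div_mul_eq_div, le_div_iff₀ hd']
  linarith

/-- For the two instances `β* = −𝟙` and `β* = 𝟙`, every `β` incurs excess loss at least `2ε`
on one of them. -/
theorem stmt15 (d : ℕ) (hd : 0 < d) (ε : ℝ) (hε0 : 0 < ε) (hε : ε < 1 / 2)
    (β : Fin d → ℝ) :
    2 * ε ≤
      max (loss d ε (fun _ => -1) β - loss d ε (fun _ => -1) (fun _ => -1))
        (loss d ε (fun _ => 1) β - loss d ε (fun _ => 1) (fun _ => 1)) := by
  have h := two_le_loss_neg_one_add_loss_one hd ε β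
  rw [loss_self_const hd ε (by simp), loss_self_const hd ε (by simp), le_max_iff]
  by_contra! hlt
  linarith [hlt.1, hlt.2]
end
end

section
/- Let d ≥ 2 be an integer. For i ∈ {1,…,d} define the loss l_i(β) = (1/d)·( Σ_{j≠i} |β_j| + (3/4)·|1 − β_i| + (1/4)·|β_i| ). Then for every β ∈ ℝ^d there is at most one index i ∈ {1,…,d} with l_i(β) < 1/(2d). -/
open Finset

noncomputable section

/-- The expected absolute error `E|Xᵀβ − Y|` when `X` is uniform over the standard basis
vectors of `ℝ^d` and `Y = Z·(Xᵀeᵢ)` with `Z` independent, `1` with probability `3/4`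
and `0` with probability `1/4`. -/
def loss3 (d : ℕ) (i : Fin d) (β : Fin d → ℝ) : ℝ :=
  (1 / d) * ((∑ j ∈ univ.erase i, |β j|) + (3 / 4) * |1 - β i| + (1 / 4) * |β i|)

/-- A loss below `1/(2d)` on instance `i` bounds the contribution of any two coordinates. -/
lemma lt_half_of_loss3_lt {d : ℕ} {i j : Fin d} (hij : i ≠ j) {β : Fin d → ℝ}
    (h : loss3 d i β < 1 / (2 * d)) :
    |β j| + (3 / 4) * |1 - β i| + (1 / 4) * |β i| < 1 / 2 := by
  have hd : (0 : ℝ) < d := by exact_mod_cast i.pos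
  have hj : |β j| ≤ ∑ k ∈ univ.erase i, |β k| :=
    single_le_sum (f := fun k => |β k|) (fun k _ => abs_nonneg _)
      (mem_erase.2 ⟨hij.symm, mem_univ j⟩)
  have hscale : (1 : ℝ) / (2 * d) = (1 / d) * (1 / 2) := by ring
  rw [loss3, hscale] at h
  have := lt_of_mul_lt_mul_left h (by positivity)
  linarith

/-- Any `β` achieves loss below `1/(2d)` on at most one instance. -/
theorem stmt17 (d : ℕ) (hd : 2 ≤ d) (β : Fin d → ℝ) :
    ∀ i j : Fin d, loss3 d i β < 1 / (2 * d) → loss3 d j β < 1 / (2 * d) → i = j := by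
  intro i j hi hj
  by_contra hij
  have h₁ := lt_half_of_loss3_lt hij hi
  have h₂ := lt_half_of_loss3_lt (Ne.symm hij) hj
  linarith [le_abs_self (β i), le_abs_self (β j), le_abs_self (1 - β i),
    le_abs_self (1 - β j), abs_nonneg (β i), abs_nonneg (β j)]
end
end
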